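/- arXiv:0811.0929 — 5 statements merged into one kernel-verified Lean document; each statement's English description precedes it below -/
import Mathlib

section
/- Let P be a time-homogeneous row-stochastic n×n matrix with a strictly positive stationary distribution π̄ (Pᵀ π̄ = π̄), and let π_t be strictly positive probability distributions with π_{t+1} = Pᵀ π_t for t ≥ t₀. Let Q(t) := D_{π_{t+1}}^{-1} Pᵀ D_{π_t} with entries q_{ji}(t), and set θ̄(t,i) := π̄(i)/π_t(i). Let X : ℕ → Ω → {1,…,n} be a process on a probability space (Ω,𝔉,ℙ), let (𝔊_t) be a nonincreasing family of sub-σ-algebras with X(t) measurable with respect to 𝔊_t, and assume the reverse-time Markov property: for every t ≥ t₀ and every f : {1,…,n} → ℝ, 𝔼[f(X(t)) | 𝔊_{t+1}] = Σ_i q_{X(t+1),i}(t) f(i) almost surely. Then the process Z̄(t) := −log θ̄(t, X(t)) is a submartingale in the reverse time direction: for every t ≥ t₀, 𝔼[−log θ̄(t, X(t)) | 𝔊_{t+1}] ≥ −log θ̄(t+1, X(t+1)) almost surely. -/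
open MeasureTheory Matrix

/-- Jensen's inequality for the logarithm, averaged against the time reversal of a forward step
`ν = Pᵀ ρ`: the ratio of the stationary vector to `ρ` is averaged to its ratio to `ν`. -/
lemma neg_log_ratio_le_sum_reversal {ι : Type*} [Fintype ι] [DecidableEq ι] {P : Matrix ι ι ℝ}
    (hP : ∀ i j, 0 ≤ P i j) {σ ρ ν : ι → ℝ} (hσ : ∀ i, 0 < σ i) (hσP : Pᵀ *ᵥ σ = σ)
    (hρ : ∀ i, 0 < ρ i) (hν : ∀ i, 0 < ν i) (hρν : ν = Pᵀ *ᵥ ρ) (j : ι) :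
    -Real.log (σ j / ν j) ≤
      ∑ i, ((Matrix.diagonal ν)⁻¹ * Pᵀ * Matrix.diagonal ρ) j i * -Real.log (σ i / ρ i) := by
  have hinv : (Matrix.diagonal ν)⁻¹ = Matrix.diagonal fun i => (ν i)⁻¹ := by
    refine Matrix.inv_eq_left_inv ?_
    simp [Matrix.diagonal_mul_diagonal, (hν _).ne']
  have hentry (i : ι) : ((Matrix.diagonal ν)⁻¹ * Pᵀ * Matrix.diagonal ρ) j i =
      (ν j)⁻¹ * P i j * ρ i := by
    rw [hinv, Matrix.mul_diagonal, Matrix.diagonal_mul, Matrix.transpose_apply]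
  simp only [hentry]
  have hsum : ∑ i, (ν j)⁻¹ * P i j * ρ i = 1 := by
    have h : ν j = ∑ i, P i j * ρ i := congrFun hρν j
    simp only [mul_assoc, ← Finset.mul_sum]
    rw [← h, inv_mul_cancel₀ (hν j).ne']
  have havg : ∑ i, (ν j)⁻¹ * P i j * ρ i * (σ i / ρ i) = σ j / ν j := by
    have h : ∑ i, P i j * σ i = σ j := congrFun hσP j
    rw [div_eq_inv_mul, ← h, Finset.mul_sum]
    refine Finset.sum_congr rfl fun i _ => ?_
    have := (hρ i).ne'
    field_simp
  have hJensen := strictConcaveOn_log_Ioi.concaveOn.le_map_sum (t := Finset.univ)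
    (w := fun i => (ν j)⁻¹ * P i j * ρ i) (p := fun i => σ i / ρ i)
    (fun i _ => mul_nonneg (mul_nonneg (inv_nonneg.2 (hν j).le) (hP i j)) (hρ i).le)
    hsum (fun i _ => div_pos (hσ i) (hρ i))
  simp only [smul_eq_mul] at hJensen
  rw [havg] at hJensen
  simpa only [mul_neg, Finset.sum_neg_distrib, neg_le_neg_iff] using hJensen

/-- **Strong form of the second law (classical).**  For a time-homogeneous chain with
strictly positive stationary distribution `π̄` and strictly positive solutions `π t` of
the forward equation, the process `Z̄ t = − log θ̄(t, X t)` with `θ̄(t,i) = π̄ i / π t i`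
is a reverse-time submartingale w.r.t. the nonincreasing family `𝔊`. -/
theorem neg_log_ratio_is_reverse_time_submartingale
    {Ω : Type*} {mΩ : MeasurableSpace Ω} {μ : Measure Ω} [IsProbabilityMeasure μ]
    {n : ℕ} (hn : 1 ≤ n)
    (P : Matrix (Fin n) (Fin n) ℝ)
    (hP_nonneg : ∀ i j, 0 ≤ P i j)
    (hP_row : ∀ i, ∑ j, P i j = 1)
    (πbar : Fin n → ℝ)
    (hπbar_pos : ∀ i, 0 < πbar i)
    (hπbar_sum : ∑ i, πbar i = 1)
    (hπbar_stat : Pᵀ *ᵥ πbar = πbar)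
    (t₀ : ℕ)
    (π : ℕ → Fin n → ℝ)
    (hπ_pos : ∀ t i, 0 < π t i)
    (hπ_sum : ∀ t, ∑ i, π t i = 1)
    (hπ_ev : ∀ t, t₀ ≤ t → π (t + 1) = Pᵀ *ᵥ π t)
    (Q : ℕ → Matrix (Fin n) (Fin n) ℝ)
    (hQ : ∀ t, Q t = (Matrix.diagonal (π (t + 1)))⁻¹ * Pᵀ * Matrix.diagonal (π t))
    (𝔊 : ℕ → MeasurableSpace Ω)
    (h𝔊_le : ∀ t, 𝔊 t ≤ mΩ)
    (h𝔊_anti : ∀ s t, s ≤ t → 𝔊 t ≤ 𝔊 s)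
    (X : ℕ → Ω → Fin n)
    (hX_meas : ∀ t, Measurable[𝔊 t] (X t))
    (hRevMarkov : ∀ (t : ℕ), t₀ ≤ t → ∀ (f : Fin n → ℝ),
      μ[fun ω => f (X t ω) | 𝔊 (t + 1)] =ᵐ[μ]
        fun ω => ∑ i, Q t (X (t + 1) ω) i * f i) :
    ∀ t, t₀ ≤ t →
      ∀ᵐ ω ∂μ,
        (μ[fun ω' => -Real.log (πbar (X t ω') / π t (X t ω')) | 𝔊 (t + 1)]) ω ≥
          -Real.log (πbar (X (t + 1) ω) / π (t + 1) (X (t + 1) ω)) := by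
  intro t ht
  filter_upwards [hRevMarkov t ht fun i => -Real.log (πbar i / π t i)] with ω hω
  rw [hω, hQ t]
  exact neg_log_ratio_le_sum_reversal hP_nonneg hπbar_pos hπbar_stat (hπ_pos t)
    (hπ_pos (t + 1)) (hπ_ev t ht) (X (t + 1) ω)
end

section
/- Let P be a row-stochastic n×n matrix with a strictly positive stationary distribution π̄ (Pᵀ π̄ = π̄), and let π be a strictly positive probability distribution on {1,…,n}. Then the relative entropy from π̄ is nonincreasing under the forward evolution: 𝔻(Pᵀπ ‖ π̄) ≤ 𝔻(π ‖ π̄), where for strictly positive distributions p, q on {1,…,n}, 𝔻(p‖q) := Σ_i p(i) log(p(i)/q(i)). (Note that Pᵀπ is automatically strictly positive, since π̄(j) > 0 forces some p_{ij} > 0.) -/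
open Matrix

/-- The log-sum inequality, with nonnegative weights `c`. -/
theorem Real.weighted_log_sum_inequality {ι : Type*} (s : Finset ι) {c a b : ι → ℝ}
    (hc : ∀ i ∈ s, 0 ≤ c i) (ha : ∀ i ∈ s, 0 ≤ a i) (hb : ∀ i ∈ s, 0 < b i)
    (hcb : 0 < ∑ i ∈ s, c i * b i) :
    (∑ i ∈ s, c i * a i) * Real.log ((∑ i ∈ s, c i * a i) / ∑ i ∈ s, c i * b i) ≤
      ∑ i ∈ s, c i * (a i * Real.log (a i / b i)) := by
  set B := ∑ i ∈ s, c i * b i with hB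
  have jensen := Real.convexOn_mul_log.map_sum_le (t := s)
    (w := fun i => c i * b i / B) (p := fun i => a i / b i)
    (fun i hi => div_nonneg (mul_nonneg (hc i hi) (hb i hi).le) hcb.le)
    (by rw [← Finset.sum_div, ← hB, div_self hcb.ne'])
    (fun i hi => div_nonneg (ha i hi) (hb i hi).le)
  have mean : ∑ i ∈ s, (c i * b i / B) • (a i / b i) = (∑ i ∈ s, c i * a i) / B := by
    rw [Finset.sum_div]
    refine Finset.sum_congr rfl fun i hi => ?_
    have := (hb i hi).ne'
    simp only [smul_eq_mul]
    field_simp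
  have mean_log : ∑ i ∈ s, (c i * b i / B) • (a i / b i * Real.log (a i / b i)) =
      (∑ i ∈ s, c i * (a i * Real.log (a i / b i))) / B := by
    rw [Finset.sum_div]
    refine Finset.sum_congr rfl fun i hi => ?_
    have := (hb i hi).ne'
    simp only [smul_eq_mul]
    field_simp
  rw [mean, mean_log, div_mul_eq_mul_div] at jensen
  exact (div_le_div_iff_of_pos_right hcb).mp jensen

/-- **The second law for Markov chains (H-theorem).**  If `π̄` is a strictly positive
stationary distribution of a row-stochastic matrix `P`, then for any strictly positive
distribution `π`, the relative entropy `𝔻(Pᵀπ ‖ π̄) ≤ 𝔻(π ‖ π̄)`, where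
`𝔻(p‖q) = Σ_i p i * log (p i / q i)`. -/
theorem relative_entropy_nonincreasing
    {n : ℕ} (hn : 1 ≤ n)
    (P : Matrix (Fin n) (Fin n) ℝ)
    (hP_nonneg : ∀ i j, 0 ≤ P i j)
    (hP_row : ∀ i, ∑ j, P i j = 1)
    (πbar : Fin n → ℝ)
    (hπbar_pos : ∀ i, 0 < πbar i)
    (hπbar_sum : ∑ i, πbar i = 1)
    (hπbar_stat : Pᵀ *ᵥ πbar = πbar)
    (π : Fin n → ℝ)
    (hπ_pos : ∀ i, 0 < π i)
    (hπ_sum : ∑ i, π i = 1) :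
    ∑ i, (Pᵀ *ᵥ π) i * Real.log ((Pᵀ *ᵥ π) i / πbar i) ≤
      ∑ i, π i * Real.log (π i / πbar i) := by
  have evolve (v : Fin n → ℝ) (j : Fin n) : (Pᵀ *ᵥ v) j = ∑ i, P i j * v i := rfl
  have stat (j : Fin n) : ∑ i, P i j * πbar i = πbar j := congrFun hπbar_stat j
  calc ∑ j, (Pᵀ *ᵥ π) j * Real.log ((Pᵀ *ᵥ π) j / πbar j)
      ≤ ∑ j, ∑ i, P i j * (π i * Real.log (π i / πbar i)) := by
        refine Finset.sum_le_sum fun j _ => ?_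
        have h := Real.weighted_log_sum_inequality Finset.univ (fun i _ => hP_nonneg i j)
          (fun i _ => (hπ_pos i).le) (fun i _ => hπbar_pos i) ((stat j).symm ▸ hπbar_pos j)
        rwa [stat, ← evolve] at h
    _ = ∑ i, π i * Real.log (π i / πbar i) := by
        rw [Finset.sum_comm]
        simp_rw [← Finset.sum_mul, hP_row, one_mul]
end

section
/- Let ρ be a positive semidefinite complex n×n matrix, let M₁,…,M_m be complex n×n matrices, and set ρ' := Σ_k M_k ρ M_kᴴ. Let Π be the orthogonal projection onto the range of ρ (Π = Πᴴ, Π² = Π, column space of Π equals column space of ρ) and Π' the orthogonal projection onto the range of ρ'. Then for every positive semidefinite matrix σ whose support is contained in the support of ρ (i.e. Π σ Π = σ): Σ_k Π' M_k Π σ Π M_kᴴ Π' = Σ_k M_k σ M_kᴴ. In other words, the time reversal of the time-reversal operation agrees with the original channel on all states supported on the support of ρ. -/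
open Matrix
open scoped ComplexOrder

/-- A matrix whose column space lies in that of `B` factors through `B` on the left. -/
lemma exists_eq_mul_of_range_mulVecLin_le {l m n R : Type*} [Fintype m] [Fintype n]
    [DecidableEq m] [CommSemiring R] {A : Matrix l m R} {B : Matrix l n R}
    (h : LinearMap.range A.mulVecLin ≤ LinearMap.range B.mulVecLin) :
    ∃ X : Matrix n m R, A = B * X := by
  have hcol (j : m) : ∃ x, B *ᵥ x = A.col j := by
    simpa using h (LinearMap.mem_range_self A.mulVecLin (Pi.single j 1))
  choose x hx using hcol
  refine ⟨Matrix.of fun i j => x j i, ?_⟩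
  ext i j
  exact (congrFun (hx j) i).symm

/-- If a sum of matrices `C k * (C k)ᴴ` vanishes, then so does every `C k`. -/
lemma eq_zero_of_sum_mul_conjTranspose_eq_zero {ι m n : Type*} [Fintype ι] [Fintype m]
    [Fintype n] {C : ι → Matrix m n ℂ} (h : ∑ k, C k * (C k)ᴴ = 0) (k : ι) : C k = 0 := by
  have htr : ∑ k, (C k * (C k)ᴴ).trace = 0 := by
    rw [← Matrix.trace_sum, h, Matrix.trace_zero]
  rw [Finset.sum_eq_zero_iff_of_nonneg fun k _ =>
    (Matrix.posSemidef_self_mul_conjTranspose (C k)).trace_nonneg] at htr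
  exact Matrix.trace_mul_conjTranspose_self_eq_zero_iff.mp (htr k (Finset.mem_univ k))

open scoped MatrixOrder Matrix.Norms.L2Operator in
/-- A matrix annihilating `∑ k, M k * ρ * (M k)ᴴ` annihilates every `M k * ρ`. -/
lemma mul_mul_eq_zero_of_mul_sum_eq_zero {ι n : Type*} [Fintype ι] [Fintype n]
    {ρ : Matrix n n ℂ} (hρ : ρ.PosSemidef) {M : ι → Matrix n n ℂ} {Q : Matrix n n ℂ}
    (hQ : Q * ∑ k, M k * ρ * (M k)ᴴ = 0) (k : ι) : Q * M k * ρ = 0 := by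
  classical
  obtain ⟨B, rfl⟩ := CStarAlgebra.nonneg_iff_eq_star_mul_self.mp hρ.nonneg
  rw [Matrix.star_eq_conjTranspose] at hQ ⊢
  have hsum : ∑ k, (Q * M k * Bᴴ) * (Q * M k * Bᴴ)ᴴ = 0 := by
    rw [← Matrix.zero_mul Qᴴ, ← hQ, Matrix.mul_sum, Matrix.sum_mul]
    simp only [Matrix.conjTranspose_mul, Matrix.conjTranspose_conjTranspose, Matrix.mul_assoc]
  rw [← Matrix.mul_assoc, eq_zero_of_sum_mul_conjTranspose_eq_zero hsum k, Matrix.zero_mul]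

/-- **The time reversal of the time-reversal agrees with the original channel on states
supported on the support of `ρ`.**  With `Prj`, `Prj'` the orthogonal projections onto
the ranges of `ρ` and `ρ' = Σ_k M_k ρ M_kᴴ` respectively, for every positive
semidefinite `σ` with `Prj σ Prj = σ` one has
`Σ_k Prj' M_k Prj σ Prj M_kᴴ Prj' = Σ_k M_k σ M_kᴴ`. -/
theorem double_time_reversal_is_original_channel
    {n m : ℕ}
    (ρ : Matrix (Fin n) (Fin n) ℂ) (hρ : ρ.PosSemidef)
    (M : Fin m → Matrix (Fin n) (Fin n) ℂ)
    (ρ' : Matrix (Fin n) (Fin n) ℂ) (hρ' : ρ' = ∑ k, M k * ρ * (M k)ᴴ)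
    (Prj : Matrix (Fin n) (Fin n) ℂ)
    (hPrj_herm : Prjᴴ = Prj) (hPrj_idem : Prj * Prj = Prj)
    (hPrj_range : LinearMap.range Prj.mulVecLin = LinearMap.range ρ.mulVecLin)
    (Prj' : Matrix (Fin n) (Fin n) ℂ)
    (hPrj'_herm : Prj'ᴴ = Prj') (hPrj'_idem : Prj' * Prj' = Prj')
    (hPrj'_range : LinearMap.range Prj'.mulVecLin = LinearMap.range ρ'.mulVecLin)
    (σ : Matrix (Fin n) (Fin n) ℂ) (hσ : σ.PosSemidef)
    (hσ_supp : Prj * σ * Prj = σ) :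
    ∑ k, Prj' * M k * Prj * σ * Prj * (M k)ᴴ * Prj' = ∑ k, M k * σ * (M k)ᴴ := by
  have hfix (k) : Prj' * M k * Prj = M k * Prj := by
    obtain ⟨X, hX⟩ := exists_eq_mul_of_range_mulVecLin_le hPrj_range.le
    obtain ⟨Y, hY⟩ := exists_eq_mul_of_range_mulVecLin_le hPrj'_range.ge
    have hQ : (1 - Prj') * ∑ k, M k * ρ * (M k)ᴴ = 0 := by
      rw [← hρ', hY, ← Matrix.mul_assoc, Matrix.sub_mul, hPrj'_idem, Matrix.one_mul, sub_self,
        Matrix.zero_mul]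
    have hzero : (1 - Prj') * M k * Prj = 0 := by
      rw [hX, ← Matrix.mul_assoc, mul_mul_eq_zero_of_mul_sum_eq_zero hρ hQ k, Matrix.zero_mul]
    rw [Matrix.sub_mul, Matrix.sub_mul, Matrix.one_mul, sub_eq_zero] at hzero
    exact hzero.symm
  refine Finset.sum_congr rfl fun k _ => ?_
  have hfix' : Prj * (M k)ᴴ * Prj' = Prj * (M k)ᴴ := by
    simpa [Matrix.conjTranspose_mul, hPrj_herm, hPrj'_herm, Matrix.mul_assoc] using
      congrArg Matrix.conjTranspose (hfix k)
  calc Prj' * M k * Prj * σ * Prj * (M k)ᴴ * Prj'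
      = (Prj' * M k * Prj) * σ * (Prj * (M k)ᴴ * Prj') := by simp only [Matrix.mul_assoc]
    _ = M k * (Prj * σ * Prj) * (M k)ᴴ := by
      rw [hfix, hfix']; simp only [Matrix.mul_assoc]
    _ = M k * σ * (M k)ᴴ := by rw [hσ_supp]
end

section
/- Let I ⊆ ℝ be an interval, let f : I → ℝ be convex, let ρ be a density matrix (positive semidefinite complex n×n matrix of unit trace), and let X be a Hermitian n×n matrix whose eigenvalues all lie in I. Then trace(ρX) is real and lies in I, trace(ρ·f(X)) is real, and trace(ρ·f(X)) ≥ f(trace(ρX)). -/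
open Matrix
open scoped ComplexOrder

/-- The action `f(A)` of a real function on a Hermitian matrix `A`, via the spectral
decomposition `A = U diag(λ) Uᴴ`; junk value `0` if `A` is not Hermitian. -/
noncomputable def matFun {n : ℕ} (f : ℝ → ℝ) (A : Matrix (Fin n) (Fin n) ℂ) :
    Matrix (Fin n) (Fin n) ℂ :=
  if hA : A.IsHermitian then
    (hA.eigenvectorUnitary : Matrix (Fin n) (Fin n) ℂ) *
      Matrix.diagonal (fun i => (f (hA.eigenvalues i) : ℂ)) *
      (star hA.eigenvectorUnitary : Matrix (Fin n) (Fin n) ℂ)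
  else 0

namespace Matrix

variable {m : Type*} [Fintype m] [DecidableEq m]

lemma trace_mul_mul_diagonal_mul (A U V : Matrix m m ℂ) (d : m → ℂ) :
    (A * (U * diagonal d * V)).trace = ∑ i, (V * A * U) i i * d i := by
  rw [← Matrix.mul_assoc, Matrix.trace_mul_comm, ← Matrix.mul_assoc, ← Matrix.mul_assoc]
  simp [Matrix.trace, Matrix.mul_diagonal]

/-- Conjugating a density matrix by a unitary leaves a probability vector on the diagonal. -/
lemma PosSemidef.exists_weights_trace_mul {ρ : Matrix m m ℂ} (hρ : ρ.PosSemidef)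
    (hρ_tr : ρ.trace = 1) (U : unitaryGroup m ℂ) :
    ∃ w : m → ℝ, (∀ i, 0 ≤ w i) ∧ ∑ i, w i = 1 ∧ ∀ d : m → ℝ,
      (ρ * ((U : Matrix m m ℂ) * diagonal (fun i => (d i : ℂ)) *
        (star U : Matrix m m ℂ))).trace = ((∑ i, w i * d i : ℝ) : ℂ) := by
  have hpsd : ((star U : Matrix m m ℂ) * ρ * U).PosSemidef :=
    hρ.conjTranspose_mul_mul_same (U : Matrix m m ℂ)
  have hre (i : m) : (((star U : Matrix m m ℂ) * ρ * U) i i) =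
      ((((star U : Matrix m m ℂ) * ρ * U) i i).re : ℂ) :=
    Complex.eq_re_of_ofReal_le (r := 0) (by simpa using hpsd.diag_nonneg (i := i))
  have key (d : m → ℝ) :
      (ρ * ((U : Matrix m m ℂ) * diagonal (fun i => (d i : ℂ)) *
        (star U : Matrix m m ℂ))).trace =
      ((∑ i, (((star U : Matrix m m ℂ) * ρ * U) i i).re * d i : ℝ) : ℂ) := by
    rw [trace_mul_mul_diagonal_mul]
    push_cast
    exact Finset.sum_congr rfl fun i _ => by rw [← hre i]
  refine ⟨fun i => (((star U : Matrix m m ℂ) * ρ * U) i i).re, fun i => ?_, ?_, key⟩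
  · exact (Complex.le_def.1 (hpsd.diag_nonneg (i := i))).1
  · have h := key 1
    have hU : (U : Matrix m m ℂ) * (star U : Matrix m m ℂ) = 1 := Unitary.coe_mul_star_self U
    simp only [Pi.one_apply, Complex.ofReal_one, diagonal_one, mul_one, hU, hρ_tr] at h
    exact_mod_cast h.symm

end Matrix

/-- **Expectation form of Jensen's inequality.**  For a convex `f` on an interval `I`,
a density matrix `ρ` and a Hermitian `X` with eigenvalues in `I`:
`trace(ρX)` is real and lies in `I`, `trace(ρ f(X))` is real, and
`trace(ρ f(X)) ≥ f(trace(ρX))`. -/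
theorem expectation_jensen_inequality
    {n : ℕ} (hn : 1 ≤ n)
    (I : Set ℝ) (hI : Convex ℝ I)
    (f : ℝ → ℝ) (hf : ConvexOn ℝ I f)
    (ρ : Matrix (Fin n) (Fin n) ℂ) (hρ : ρ.PosSemidef) (hρ_tr : ρ.trace = 1)
    (X : Matrix (Fin n) (Fin n) ℂ) (hX : X.IsHermitian)
    (hspec : ∀ i, hX.eigenvalues i ∈ I) :
    (ρ * X).trace = ((ρ * X).trace.re : ℂ) ∧
    (ρ * X).trace.re ∈ I ∧
    (ρ * matFun f X).trace = ((ρ * matFun f X).trace.re : ℂ) ∧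
    f ((ρ * X).trace.re) ≤ (ρ * matFun f X).trace.re := by
  obtain ⟨w, hw0, hw1, hw⟩ := hρ.exists_weights_trace_mul hρ_tr hX.eigenvectorUnitary
  have hX_tr : (ρ * X).trace = ((∑ i, w i * hX.eigenvalues i : ℝ) : ℂ) := by
    rw [← hw]
    congr 2
    exact hX.spectral_theorem
  have hf_tr : (ρ * matFun f X).trace = ((∑ i, w i * f (hX.eigenvalues i) : ℝ) : ℂ) := by
    rw [matFun, dif_pos hX, ← hw]
  rw [hX_tr, hf_tr, Complex.ofReal_re, Complex.ofReal_re]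
  refine ⟨rfl, ?_, rfl, ?_⟩
  · exact hI.sum_mem (fun i _ => hw0 i) hw1 (fun i _ => hspec i)
  · exact hf.map_sum_le (fun i _ => hw0 i) hw1 (fun i _ => hspec i)
end

section
/- Let I ⊆ ℝ be an interval and let f : ℝ → ℝ be operator convex on I, i.e. for all Hermitian n×n matrices A, B whose eigenvalues lie in I and all λ ∈ [0,1], f(λA + (1−λ)B) ≤ λ f(A) + (1−λ) f(B) in the Loewner order. Let M₁,…,M_m be complex n×n matrices with Σ_k M_kᴴ M_k = I, and let Y be a Hermitian n×n matrix whose eigenvalues lie in I. Then the eigenvalues of 𝓔(Y) := Σ_k M_kᴴ Y M_k also lie in I, and f(𝓔(Y)) ≤ Σ_k M_kᴴ f(Y) M_k = 𝓔(f(Y)). In particular, if {Y_t} is space-time harmonic for such unital maps, then {f(Y_t)} is space-time subharmonic. -/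
open Matrix
open scoped ComplexOrder

/-- `f` is operator convex on the interval `I`: for Hermitian matrices (of any size)
with spectrum in `I`, `f(λA + (1−λ)B) ≤ λ f(A) + (1−λ) f(B)` in the Loewner order. -/
def OperatorConvexOn (I : Set ℝ) (f : ℝ → ℝ) : Prop :=
  ∀ (N : ℕ) (A B : Matrix (Fin N) (Fin N) ℂ) (hA : A.IsHermitian) (hB : B.IsHermitian),
    (∀ i, hA.eigenvalues i ∈ I) → (∀ i, hB.eigenvalues i ∈ I) →
    ∀ lam : ℝ, 0 ≤ lam → lam ≤ 1 →
      (lam • matFun f A + (1 - lam) • matFun f B -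
        matFun f ((lam : ℂ) • A + ((1 : ℂ) - lam) • B)).PosSemidef

/-- The spectral functional calculus respects intertwining relations. -/
theorem matFun_mul_eq_mul_matFun {p q : ℕ} (f : ℝ → ℝ) {A : Matrix (Fin q) (Fin q) ℂ}
    {B : Matrix (Fin p) (Fin p) ℂ} (hA : A.IsHermitian) (hB : B.IsHermitian)
    {X : Matrix (Fin p) (Fin q) ℂ} (h : B * X = X * A) :
    matFun f B * X = X * matFun f A := by
  simp only [matFun, dif_pos hA, dif_pos hB]
  have eA := hA.spectral_theorem
  have eB := hB.spectral_theorem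
  rw [Unitary.conjStarAlgAut_apply] at eA eB
  set U : Matrix (Fin q) (Fin q) ℂ := (hA.eigenvectorUnitary : Matrix (Fin q) (Fin q) ℂ)
  set W : Matrix (Fin p) (Fin p) ℂ := (hB.eigenvectorUnitary : Matrix (Fin p) (Fin p) ℂ)
  have a1 : star U * U = 1 := Unitary.coe_star_mul_self hA.eigenvectorUnitary
  have a2 : U * star U = 1 := Unitary.coe_mul_star_self hA.eigenvectorUnitary
  have b1 : star W * W = 1 := Unitary.coe_star_mul_self hB.eigenvectorUnitary
  have b2 : W * star W = 1 := Unitary.coe_mul_star_self hB.eigenvectorUnitary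
  have key : diagonal (fun i => (hB.eigenvalues i : ℂ)) * (star W * X * U) =
      (star W * X * U) * diagonal (fun i => (hA.eigenvalues i : ℂ)) := by
    have e1 : star W * (B * X) * U = star W * (X * A) * U := by rw [h]
    calc _ = (star W * W) * diagonal (fun i => (hB.eigenvalues i : ℂ)) * star W * X * U := by
          rw [b1]; simp only [Matrix.one_mul, Matrix.mul_assoc]
      _ = star W * (B * X) * U := by
          conv_rhs => rw [eB]
          simp only [Matrix.mul_assoc]; rfl
      _ = star W * X * U * diagonal (fun i => (hA.eigenvalues i : ℂ)) * (star U * U) := by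
          rw [e1]
          conv_lhs => rw [eA]
          simp only [Matrix.mul_assoc]; rfl
      _ = _ := by rw [a1, Matrix.mul_one]
  have key' : diagonal (fun i => (f (hB.eigenvalues i) : ℂ)) * (star W * X * U) =
      (star W * X * U) * diagonal (fun i => (f (hA.eigenvalues i) : ℂ)) := by
    ext i j
    have hij := congrFun (congrFun key i) j
    rw [diagonal_mul, mul_diagonal] at hij ⊢
    by_cases hG : (star W * X * U) i j = 0
    · simp [hG]
    · rw [mul_comm] at hij
      have : hB.eigenvalues i = hA.eigenvalues j := by
        exact_mod_cast mul_left_cancel₀ hG hij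
      rw [this, mul_comm]
  calc _ = W * (diagonal (fun i => (f (hB.eigenvalues i) : ℂ)) * (star W * X * U)) * star U := by
        simp only [Matrix.mul_assoc, a2, Matrix.mul_one]
    _ = (W * star W) * X * U * diagonal (fun i => (f (hA.eigenvalues i) : ℂ)) * star U := by
        rw [key']; simp only [Matrix.mul_assoc]
    _ = _ := by rw [b2, Matrix.one_mul]; simp only [Matrix.mul_assoc]

theorem isHermitian_sum_conjTranspose_mul_mul {ι : Type*} [Fintype ι] {p q : ℕ}
    (M : ι → Matrix (Fin p) (Fin q) ℂ) {Y : Matrix (Fin p) (Fin p) ℂ} (hY : Y.IsHermitian) :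
    (∑ k, (M k)ᴴ * Y * M k).IsHermitian := by
  simp only [IsHermitian, conjTranspose_sum, conjTranspose_mul, conjTranspose_conjTranspose,
    hY.eq, Matrix.mul_assoc]

/-- A unital completely positive map keeps the spectrum inside any convex set. -/
theorem eigenvalues_sum_conjTranspose_mul_mul_mem {ι : Type*} [Fintype ι] {I : Set ℝ}
    (hI : Convex ℝ I) {p q : ℕ} (M : ι → Matrix (Fin p) (Fin q) ℂ)
    (hM : ∑ k, (M k)ᴴ * M k = 1) {Y : Matrix (Fin p) (Fin p) ℂ} (hY : Y.IsHermitian)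
    (hYspec : ∀ i, hY.eigenvalues i ∈ I) {E : Matrix (Fin q) (Fin q) ℂ} (hE : E.IsHermitian)
    (hEM : E = ∑ k, (M k)ᴴ * Y * M k) (i : Fin q) : hE.eigenvalues i ∈ I := by
  have eE := hE.spectral_theorem
  have eY := hY.spectral_theorem
  rw [Unitary.conjStarAlgAut_apply] at eE eY
  set U : Matrix (Fin q) (Fin q) ℂ := (hE.eigenvectorUnitary : Matrix (Fin q) (Fin q) ℂ)
  set W : Matrix (Fin p) (Fin p) ℂ := (hY.eigenvectorUnitary : Matrix (Fin p) (Fin p) ℂ)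
  have a1 : star U * U = 1 := Unitary.coe_star_mul_self hE.eigenvectorUnitary
  have b2 : W * star W = 1 := Unitary.coe_mul_star_self hY.eigenvectorUnitary
  let G : ι → Matrix (Fin p) (Fin q) ℂ := fun k => star W * M k * U
  have hG (k : ι) : (G k)ᴴ = star U * (M k)ᴴ * W := by
    simp [G, star_eq_conjTranspose, Matrix.mul_assoc]
  have entry (d : Fin p → ℝ) : (∑ k, (G k)ᴴ * diagonal (fun j => (d j : ℂ)) * G k) i i =
      ((∑ x : ι × Fin p, Complex.normSq (G x.1 x.2 i) * d x.2 : ℝ) : ℂ) := by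
    rw [Matrix.sum_apply, Fintype.sum_prod_type, Complex.ofReal_sum]
    refine Finset.sum_congr rfl fun k _ => ?_
    rw [Matrix.mul_apply, Complex.ofReal_sum]
    refine Finset.sum_congr rfl fun j _ => ?_
    rw [mul_diagonal, conjTranspose_apply, Complex.ofReal_mul, ← Complex.mul_conj]
    simp only [Complex.star_def]
    ring
  have hone : ∑ k, (G k)ᴴ * diagonal (fun _ : Fin p => ((1 : ℝ) : ℂ)) * G k = 1 := by
    have h1 (k : ι) : (G k)ᴴ * diagonal (fun _ : Fin p => ((1 : ℝ) : ℂ)) * G k =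
        star U * ((M k)ᴴ * M k) * U := by
      rw [hG, Complex.ofReal_one, diagonal_one, Matrix.mul_one]
      calc _ = star U * (M k)ᴴ * (W * star W) * M k * U := by
            simp only [G, Matrix.mul_assoc]
        _ = _ := by rw [b2, Matrix.mul_one]; simp only [Matrix.mul_assoc]
    rw [Finset.sum_congr rfl fun k _ => h1 k, ← Finset.sum_mul, ← Finset.mul_sum, hM,
      Matrix.mul_one, a1]
  have hval : ∑ k, (G k)ᴴ * diagonal (fun j => (hY.eigenvalues j : ℂ)) * G k =
      diagonal (fun j => (hE.eigenvalues j : ℂ)) := by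
    have h1 (k : ι) : (G k)ᴴ * diagonal (fun j => (hY.eigenvalues j : ℂ)) * G k =
        star U * ((M k)ᴴ * Y * M k) * U := by
      rw [hG]
      conv_rhs => rw [eY]
      simp only [G, Matrix.mul_assoc]; rfl
    rw [Finset.sum_congr rfl fun k _ => h1 k, ← Finset.sum_mul, ← Finset.mul_sum, ← hEM]
    calc star U * E * U
        = (star U * U) * diagonal (fun j => (hE.eigenvalues j : ℂ)) * (star U * U) := by
          conv_lhs => rw [eE]
          simp only [Matrix.mul_assoc]; rfl
      _ = _ := by rw [a1, Matrix.one_mul, Matrix.mul_one]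
  have s1 : ∑ x : ι × Fin p, Complex.normSq (G x.1 x.2 i) = 1 := by
    have := entry fun _ => 1
    rw [hone, one_apply_eq] at this
    simp only [mul_one] at this
    exact_mod_cast this.symm
  have s2 : ∑ x : ι × Fin p, Complex.normSq (G x.1 x.2 i) * hY.eigenvalues x.2 =
      hE.eigenvalues i := by
    have := entry hY.eigenvalues
    rw [hval, diagonal_apply_eq] at this
    exact_mod_cast this.symm
  rw [← s2]
  exact hI.sum_mem (fun _ _ => Complex.normSq_nonneg _) s1 fun x _ => hYspec x.2

/-- Jensen's inequality for compressions by an isometry, obtained by pinching with the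
reflection `2 V Vᴴ - 1`. -/
theorem OperatorConvexOn.posSemidef_isometry {I : Set ℝ} (hI : Convex ℝ I) {f : ℝ → ℝ}
    (hf : OperatorConvexOn I f) {p q : ℕ} {V : Matrix (Fin p) (Fin q) ℂ} (hV : Vᴴ * V = 1)
    {T : Matrix (Fin p) (Fin p) ℂ} (hT : T.IsHermitian) (hTspec : ∀ i, hT.eigenvalues i ∈ I) :
    (Vᴴ * matFun f T * V - matFun f (Vᴴ * T * V)).PosSemidef := by
  let R : Matrix (Fin p) (Fin p) ℂ := (2 : ℂ) • (V * Vᴴ) - 1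
  have hRV : R * V = V := by
    simp only [R, Matrix.sub_mul, Matrix.smul_mul, Matrix.mul_assoc, hV, Matrix.mul_one,
      Matrix.one_mul]
    module
  have hRH : Rᴴ = R := by
    simp [R, conjTranspose_sub, conjTranspose_smul]
  have hVR : Vᴴ * R = Vᴴ := by
    simpa [hRH] using congrArg conjTranspose hRV
  have hRR : R * R = 1 := by
    calc R * R = (2 : ℂ) • (R * V * Vᴴ) - R := by
          conv_lhs => rw [show R * R = R * ((2 : ℂ) • (V * Vᴴ) - 1) from rfl]
          simp only [Matrix.mul_sub, Matrix.mul_smul, Matrix.mul_one, Matrix.mul_assoc]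
      _ = 1 := by rw [hRV]; simp [R]
  have hRT : (R * T * R).IsHermitian := by
    simpa [hRH] using isHermitian_conjTranspose_mul_mul R hT
  have hRTspec (i) : hRT.eigenvalues i ∈ I :=
    eigenvalues_sum_conjTranspose_mul_mul_mem hI (fun _ : Unit => R)
      (by simp [hRH, hRR]) hT hTspec hRT (by simp [hRH]) i
  have hfR : matFun f (R * T * R) = R * matFun f T * R := by
    have := matFun_mul_eq_mul_matFun f hT hRT (X := R)
      (by simp only [Matrix.mul_assoc, hRR, Matrix.mul_one])
    rw [← this, Matrix.mul_assoc (matFun f _), hRR, Matrix.mul_one]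
  have hconv := hf p T (R * T * R) hT hRT hTspec hRTspec (1 / 2) (by norm_num) (by norm_num)
  set D := ((1 / 2 : ℝ) : ℂ) • T + ((1 : ℂ) - ((1 / 2 : ℝ) : ℂ)) • (R * T * R) with hD
  have hc : (1 : ℂ) - ((1 / 2 : ℝ) : ℂ) = ((1 / 2 : ℝ) : ℂ) := by push_cast; norm_num
  have hDH : D.IsHermitian := by
    rw [hD, hc]
    simp only [IsHermitian, conjTranspose_add, conjTranspose_smul, hT.eq, hRT.eq,
      Complex.star_def, Complex.conj_ofReal]
  have hDV : D * V = V * (Vᴴ * T * V) := by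
    have h1 : R * T * R * V = (2 : ℂ) • (V * (Vᴴ * T * V)) - T * V := by
      rw [Matrix.mul_assoc (R * T), hRV]
      simp only [R, Matrix.sub_mul, Matrix.smul_mul, Matrix.mul_assoc, Matrix.one_mul]
    rw [hD, hc, Matrix.add_mul, Matrix.smul_mul, Matrix.smul_mul, h1]
    push_cast
    module
  have hVTV : (Vᴴ * T * V).IsHermitian := isHermitian_conjTranspose_mul_mul V hT
  have hfD : Vᴴ * matFun f D * V = matFun f (Vᴴ * T * V) := by
    rw [Matrix.mul_assoc, matFun_mul_eq_mul_matFun f hVTV hDH hDV, ← Matrix.mul_assoc, hV,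
      Matrix.one_mul]
  have hmain := hconv.conjTranspose_mul_mul_same V
  have hRfR : Vᴴ * (R * matFun f T * R) * V = Vᴴ * matFun f T * V := by
    calc _ = (Vᴴ * R) * matFun f T * (R * V) := by simp only [Matrix.mul_assoc]
      _ = _ := by rw [hVR, hRV]
  have heq : Vᴴ * ((1 / 2 : ℝ) • matFun f T + (1 - (1 / 2 : ℝ)) • matFun f (R * T * R) -
      matFun f D) * V = Vᴴ * matFun f T * V - matFun f (Vᴴ * T * V) := by
    rw [hfR, Matrix.mul_sub, Matrix.sub_mul, hfD, Matrix.mul_add, Matrix.add_mul,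
      Matrix.mul_smul, Matrix.smul_mul, Matrix.mul_smul, Matrix.smul_mul, hRfR]
    module
  rwa [heq] at hmain

/-- The coisometry reading off the `k`-th block of size `n` of a vector of size `n * m`. -/
def blockProj (n : ℕ) {m : ℕ} (k : Fin m) : Matrix (Fin n) (Fin (n * m)) ℂ :=
  (1 : Matrix (Fin (n * m)) (Fin (n * m)) ℂ).submatrix (fun a => finProdFinEquiv (a, k)) id

theorem blockProj_mul_conjTranspose (n : ℕ) {m : ℕ} (k l : Fin m) :
    blockProj n k * (blockProj n l)ᴴ = if k = l then 1 else 0 := by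
  have h : blockProj n k * (blockProj n l)ᴴ =
      (1 : Matrix (Fin (n * m)) (Fin (n * m)) ℂ).submatrix
        (fun a => finProdFinEquiv (a, k)) (fun a => finProdFinEquiv (a, l)) := by
    rw [blockProj, blockProj, conjTranspose_submatrix, conjTranspose_one,
      ← submatrix_mul _ _ _ id _ Function.bijective_id, Matrix.one_mul]
  rw [h]
  ext a b
  by_cases hkl : k = l <;> simp [hkl, one_apply]

theorem sum_conjTranspose_blockProj_mul (n m : ℕ) :
    ∑ k : Fin m, (blockProj n k)ᴴ * blockProj n k = 1 := by
  ext x y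
  obtain ⟨⟨a, k⟩, rfl⟩ := finProdFinEquiv.surjective x
  obtain ⟨⟨b, l⟩, rfl⟩ := finProdFinEquiv.surjective y
  simp only [Matrix.sum_apply, Matrix.mul_apply, blockProj, conjTranspose_apply, submatrix_apply,
    one_apply, id, EmbeddingLike.apply_eq_iff_eq, Prod.mk.injEq]
  rw [← Fintype.sum_prod_type_right', Finset.sum_eq_single (a, k)]
  · simp
  · rintro ⟨c, r⟩ - hne
    have : ¬ (c = a ∧ r = k) := fun h => hne (Prod.ext h.1 h.2)
    simp [this]
  · simp

/-- Jensen's inequality for unital completely positive maps in Kraus form. -/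
theorem OperatorConvexOn.posSemidef_sum_conjTranspose_mul_mul {I : Set ℝ} (hI : Convex ℝ I)
    {f : ℝ → ℝ} (hf : OperatorConvexOn I f) {n q m : ℕ} (M : Fin m → Matrix (Fin n) (Fin q) ℂ)
    (hM : ∑ k, (M k)ᴴ * M k = 1) {Y : Matrix (Fin n) (Fin n) ℂ} (hY : Y.IsHermitian)
    (hYspec : ∀ i, hY.eigenvalues i ∈ I) :
    (∑ k, (M k)ᴴ * matFun f Y * M k - matFun f (∑ k, (M k)ᴴ * Y * M k)).PosSemidef := by
  let T := ∑ k : Fin m, (blockProj n k)ᴴ * Y * blockProj n k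
  let V := ∑ k : Fin m, (blockProj n k)ᴴ * M k
  have hT : T.IsHermitian := isHermitian_sum_conjTranspose_mul_mul _ hY
  have hTspec (i) : hT.eigenvalues i ∈ I :=
    eigenvalues_sum_conjTranspose_mul_mul_mem hI _ (sum_conjTranspose_blockProj_mul n m) hY
      hYspec hT rfl i
  have hPV (k : Fin m) : blockProj n k * V = M k := by
    simp only [V, Matrix.mul_sum, ← Matrix.mul_assoc, blockProj_mul_conjTranspose]
    rw [Finset.sum_eq_single k (fun l _ hl => by rw [if_neg hl.symm, Matrix.zero_mul]) (by simp),
      if_pos rfl, Matrix.one_mul]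
  have hTP (k : Fin m) : T * (blockProj n k)ᴴ = (blockProj n k)ᴴ * Y := by
    simp only [T, Matrix.sum_mul, Matrix.mul_assoc, blockProj_mul_conjTranspose]
    rw [Finset.sum_eq_single k
      (fun l _ hl => by rw [if_neg hl, Matrix.mul_zero, Matrix.mul_zero]) (by simp),
      if_pos rfl, Matrix.mul_one]
  have hVH : Vᴴ = ∑ k, (M k)ᴴ * blockProj n k := by
    simp [V, conjTranspose_sum]
  have hVX {Z : Matrix (Fin n) (Fin n) ℂ} {S : Matrix (Fin (n * m)) (Fin (n * m)) ℂ}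
      (hS : ∀ k : Fin m, S * (blockProj n k)ᴴ = (blockProj n k)ᴴ * Z) :
      Vᴴ * S * V = ∑ k, (M k)ᴴ * Z * M k := by
    have hSV : S * V = ∑ k, (blockProj n k)ᴴ * (Z * M k) := by
      simp only [V, Matrix.mul_sum, ← Matrix.mul_assoc, hS]
    have hVP (k : Fin m) : Vᴴ * (blockProj n k)ᴴ = (M k)ᴴ := by
      rw [← conjTranspose_mul, hPV]
    rw [Matrix.mul_assoc, hSV]
    simp only [Matrix.mul_sum, ← Matrix.mul_assoc, hVP]
  have hV : Vᴴ * V = 1 := by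
    have := hVX (Z := 1) (S := 1) (by simp)
    simpa [hM] using this
  have hmain := hf.posSemidef_isometry hI hV hT hTspec
  rwa [hVX hTP, hVX fun k => matFun_mul_eq_mul_matFun f hY hT (hTP k)] at hmain

/-- **Operator Jensen inequality and space-time subharmonicity.**
If `f` is operator convex on `I`, `Σ_k M_kᴴ M_k = I` and `Y` is Hermitian with
eigenvalues in `I`, then `𝓔(Y) = Σ_k M_kᴴ Y M_k` has eigenvalues in `I` and
`f(𝓔(Y)) ≤ 𝓔(f(Y))`.  In particular, the image under `f` of a space-time harmonic
process (for unital Kraus maps with spectra in `I`) is space-time subharmonic. -/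
theorem operator_jensen_and_subharmonicity
    (I : Set ℝ) (hI : Convex ℝ I)
    (f : ℝ → ℝ) (hf : OperatorConvexOn I f)
    {n m : ℕ}
    (M : Fin m → Matrix (Fin n) (Fin n) ℂ)
    (hM : ∑ k, (M k)ᴴ * M k = 1)
    (Y : Matrix (Fin n) (Fin n) ℂ) (hY : Y.IsHermitian)
    (hYspec : ∀ i, hY.eigenvalues i ∈ I) :
    (∃ hE : (∑ k, (M k)ᴴ * Y * M k).IsHermitian, ∀ i, hE.eigenvalues i ∈ I) ∧
    (∑ k, (M k)ᴴ * matFun f Y * M k - matFun f (∑ k, (M k)ᴴ * Y * M k)).PosSemidef ∧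
    (∀ (Yseq : ℕ → Matrix (Fin n) (Fin n) ℂ)
       (Mseq : ℕ → Fin m → Matrix (Fin n) (Fin n) ℂ),
      (∀ t, ∑ k, (Mseq t k)ᴴ * Mseq t k = 1) →
      (∀ t, ∃ h : (Yseq t).IsHermitian, ∀ i, h.eigenvalues i ∈ I) →
      (∀ t, Yseq t = ∑ k, (Mseq t k)ᴴ * Yseq (t + 1) * Mseq t k) →
      ∀ t, (∑ k, (Mseq t k)ᴴ * matFun f (Yseq (t + 1)) * Mseq t k -
              matFun f (Yseq t)).PosSemidef) := by
  refine ⟨⟨isHermitian_sum_conjTranspose_mul_mul M hY,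
      eigenvalues_sum_conjTranspose_mul_mul_mem hI M hM hY hYspec _ rfl⟩,
    hf.posSemidef_sum_conjTranspose_mul_mul hI M hM hY hYspec, ?_⟩
  intro Yseq Mseq hMseq hspec hharm t
  obtain ⟨h, hmem⟩ := hspec (t + 1)
  have := hf.posSemidef_sum_conjTranspose_mul_mul hI (Mseq t) (hMseq t) h hmem
  rwa [← hharm t] at this
end
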